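/- Let s ∈ (1/2, 1] and let x ∈ (0,1) be irrational with approximation rate r_odd(x). If s − 1 + 1/r_odd(x) > 0 (with the convention 1/∞ = 0), then the sequence of partial sums F_{s,N}(x) converges as N → ∞. -/

import Mathlib

open MeasureTheory Filter Set
open scoped Real BigOperators ENNReal

/-- Partial sum `F_{s,N}(x) = ∑_{n=1}^N n^{-s} e^{2πi n² x}`. -/
noncomputable def FsN (s : ℝ) (N : ℕ) (x : ℝ) : ℂ :=
  ∑ n ∈ Finset.Icc 1 N,
    (((n : ℝ) ^ (-s) : ℝ) : ℂ) * Complex.exp (2 * Real.pi * Complex.I * (n : ℂ) ^ 2 * (x : ℂ))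

/-- Iterates of the Gauss map: `cfX x 0 = x`, `cfX x (j+1) = frac (1 / cfX x j)`. -/
noncomputable def cfX (x : ℝ) : ℕ → ℝ
  | 0 => x
  | j + 1 => Int.fract (cfX x j)⁻¹

/-- Partial quotients: `cfA x j = a_{j+1} = ⌊1 / x_j⌋`. -/
noncomputable def cfA (x : ℝ) (j : ℕ) : ℤ := ⌊(cfX x j)⁻¹⌋

/-- Numerators of the convergents of x ∈ (0,1): `p_0 = 0`, `p_1 = 1`,
`p_{j+2} = a_{j+2} p_{j+1} + p_j`. -/
noncomputable def cfP (x : ℝ) : ℕ → ℤ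
  | 0 => 0
  | 1 => 1
  | j + 2 => cfA x (j + 1) * cfP x (j + 1) + cfP x j

/-- Denominators of the convergents of x ∈ (0,1): `q_0 = 1`, `q_1 = a_1`,
`q_{j+2} = a_{j+2} q_{j+1} + q_j`. -/
noncomputable def cfQ (x : ℝ) : ℕ → ℤ
  | 0 => 1
  | 1 => cfA x 0
  | j + 2 => cfA x (j + 1) * cfQ x (j + 1) + cfQ x j

/-- `h_j = x - p_j/q_j`. -/
noncomputable def cfH (x : ℝ) (j : ℕ) : ℝ := x - (cfP x j : ℝ) / (cfQ x j : ℝ)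

/-- `r_j`, defined by `|h_j| = q_j^{-r_j}`, i.e. `r_j = -log_{q_j} |h_j|`. -/
noncomputable def cfR (x : ℝ) (j : ℕ) : ℝ := -Real.logb (cfQ x j : ℝ) |cfH x j|

/-- The filter of large indices `j ≥ 1` whose convergent denominator `q_j` is not
twice an odd number (i.e. `q_j ≢ 2 [MOD 4]`). -/
def oddFilter (x : ℝ) : Filter ℕ :=
  Filter.atTop ⊓ Filter.principal {j : ℕ | 1 ≤ j ∧ cfQ x j % 4 ≠ 2}

/-- The approximation rate `r_odd(x) ∈ [2,∞]`: the limsup of the `r_j` over indices `j`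
with `q_j ≢ 2 [MOD 4]`. -/
noncomputable def rOdd (x : ℝ) : ℝ≥0∞ :=
  Filter.limsup (fun j => ENNReal.ofReal (cfR x j)) (oddFilter x)

/-- `δ_j`: equal to `1` when `s < 1`, and to `log (q_{j+1}/q_j)` when `s = 1`. -/
noncomputable def deltaJ (s x : ℝ) (j : ℕ) : ℝ :=
  if s < 1 then 1 else Real.log ((cfQ x (j + 1) : ℝ) / (cfQ x j : ℝ))

/-- The summand `δ_j √(q_{j+1} / (q_j q_{j+1})^s)`. -/
noncomputable def sigTerm (s x : ℝ) (j : ℕ) : ℝ :=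
  deltaJ s x j *
    Real.sqrt ((cfQ x (j + 1) : ℝ) / ((cfQ x j : ℝ) * (cfQ x (j + 1) : ℝ)) ^ s)

/-- `Σ_s(x) = ∑_{j ≥ 1, q_j ≢ 2 (4)} δ_j √(q_{j+1}/(q_j q_{j+1})^s)`, valued in `[0,∞]`. -/
noncomputable def SigmaS (s x : ℝ) : ℝ≥0∞ :=
  ∑' j : ℕ, if 1 ≤ j ∧ cfQ x j % 4 ≠ 2 then ENNReal.ofReal (sigTerm s x j) else 0


noncomputable def ee (t : ℝ) : ℂ := Complex.exp (((2 * π * t : ℝ) : ℂ) * Complex.I)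

lemma ee_add (a b : ℝ) : ee (a + b) = ee a * ee b := by
  unfold ee; rw [← Complex.exp_add]; congr 1; push_cast; ring

lemma ee_norm (t : ℝ) : ‖ee t‖ = 1 := Complex.norm_exp_ofReal_mul_I _

lemma ee_conj (t : ℝ) : (starRingEnd ℂ) (ee t) = ee (-t) := by
  unfold ee; rw [← Complex.exp_conj]; congr 1
  rw [map_mul, Complex.conj_ofReal, Complex.conj_I]; push_cast; ring

lemma ee_int (k : ℤ) : ee k = 1 := by
  unfold ee; rw [Complex.exp_eq_one_iff]; exact ⟨k, by push_cast; ring⟩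

lemma ee_half_odd (k : ℤ) (hk : Odd k) : ee ((k : ℝ) / 2) = -1 := by
  obtain ⟨j, rfl⟩ := hk
  have : (((2 * j + 1 : ℤ) : ℝ)) / 2 = (j : ℝ) + 1 / 2 := by push_cast; ring
  rw [this, ee_add, ee_int, one_mul]
  unfold ee
  rw [show ((2 * π * (1 / 2) : ℝ) : ℂ) * Complex.I = π * Complex.I by push_cast; ring]
  exact Complex.exp_pi_mul_I

lemma ee_nat_mul (n : ℕ) (t : ℝ) : ee (n * t) = ee t ^ n := by
  unfold ee; rw [← Complex.exp_nat_mul]; congr 1; push_cast; ring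

lemma ee_fract (t : ℝ) : ee t = ee (Int.fract t) := by
  conv_lhs => rw [← Int.floor_add_fract t]
  rw [ee_add, ee_int, one_mul]

lemma sin_lower (u : ℝ) (h0 : 0 < u) (h1 : u < 1) :
    1 / Real.sin (π * u) ≤ 1 / (2 * u) + 1 / (2 * (1 - u)) := by
  have hpi := Real.pi_pos
  have h1' : 0 < 1 - u := by linarith
  rcases le_total u (1/2) with h | h
  · have h2 := Real.mul_le_sin (x := π * u) (by positivity) (by nlinarith)
    have h3 : 2 / π * (π * u) = 2 * u := by field_simp
    rw [h3] at h2
    have : 1 / Real.sin (π * u) ≤ 1 / (2 * u) := one_div_le_one_div_of_le (by linarith) h2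
    have : 0 ≤ 1 / (2 * (1 - u)) := by positivity
    linarith
  · have h2 := Real.mul_le_sin (x := π * (1 - u)) (by positivity) (by nlinarith)
    have h3 : 2 / π * (π * (1 - u)) = 2 * (1 - u) := by field_simp
    rw [h3, show π * (1 - u) = π - π * u by ring, Real.sin_pi_sub] at h2
    have : 1 / Real.sin (π * u) ≤ 1 / (2 * (1 - u)) := one_div_le_one_div_of_le (by linarith) h2
    have : 0 ≤ 1 / (2 * u) := by positivity
    linarith

lemma ee_sub_one_norm (u : ℝ) (h0 : 0 < u) (h1 : u < 1) : ‖ee u - 1‖ = 2 * Real.sin (π * u) := by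
  have h : ee u - 1 = ee (u / 2) * (2 * Complex.I * (Real.sin (π * u) : ℝ)) := by
    have e1 : ee u = ee (u/2) * ee (u/2) := by rw [← ee_add]; congr 1; ring
    have e2 : ee (u/2) * ee (-(u/2)) = 1 := by
      rw [← ee_add]; simpa using ee_int 0
    have e3 : ee (u/2) - ee (-(u/2)) = 2 * Complex.I * (Real.sin (π * u) : ℝ) := by
      unfold ee
      rw [show (2 * π * (u / 2) : ℝ) = π * u by ring, show (2 * π * (-(u / 2)) : ℝ) = -(π * u) by ring,
        Complex.exp_mul_I, Complex.exp_mul_I]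
      push_cast
      rw [Complex.cos_neg, Complex.sin_neg]; ring
    rw [← e3, mul_sub, e2, ← e1]
  have hs : 0 < Real.sin (π * u) := Real.sin_pos_of_pos_of_lt_pi (by have := Real.pi_pos; positivity)
    (by have := Real.pi_pos; nlinarith)
  rw [h, norm_mul, ee_norm]
  rw [norm_mul, norm_mul, Complex.norm_real, Complex.norm_I, Real.norm_of_nonneg hs.le]; simp

lemma geom_bound (t : ℝ) (K : ℕ) (h0 : 0 < Int.fract t) :
    ‖∑ n ∈ Finset.range K, ee (n * t)‖ ≤ 1 / (2 * Int.fract t) + 1 / (2 * (1 - Int.fract t)) := by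
  set u := Int.fract t with hu
  have h1 : u < 1 := Int.fract_lt_one t
  have hn := ee_sub_one_norm u h0 h1
  have hs : 0 < Real.sin (π * u) := Real.sin_pos_of_pos_of_lt_pi (by have := Real.pi_pos; positivity)
    (by have := Real.pi_pos; nlinarith)
  have hne : ee t ≠ 1 := by
    intro h
    rw [ee_fract t, ← hu] at h
    rw [h] at hn; simp at hn; linarith
  simp_rw [ee_nat_mul]
  rw [geom_sum_eq hne, norm_div]
  have h2 : ‖ee t ^ K - 1‖ ≤ 2 := by
    refine (norm_sub_le _ _).trans ?_
    rw [norm_pow, ee_norm]; norm_num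
  rw [ee_fract t, ← hu, hn]
  rw [ee_fract t, ← hu] at h2
  refine le_trans ?_ (sin_lower u h0 h1)
  rw [div_le_div_iff₀ (by positivity) hs]
  nlinarith

lemma sq_sum_expand (F : ℕ → ℕ → ℂ) (L : ℕ) :
    ∑ m ∈ Finset.range L, ∑ n ∈ Finset.range L, F m n =
      ∑ n ∈ Finset.range L, F n n + ∑ d ∈ Finset.range L, ∑ n ∈ Finset.range (L - 1 - d),
        (F (n + d + 1) n + F n (n + d + 1)) := by
  induction L with
  | zero => simp
  | succ L ih =>
    have e1 : ∑ m ∈ Finset.range (L+1), ∑ n ∈ Finset.range (L+1), F m n =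
        ∑ m ∈ Finset.range L, ∑ n ∈ Finset.range L, F m n + F L L +
          ∑ n ∈ Finset.range L, (F L n + F n L) := by
      simp_rw [Finset.sum_range_succ, Finset.sum_add_distrib]; ring
    rw [e1, ih, Finset.sum_range_succ (n := L), Finset.sum_range_succ (n := L)]
    have e2 : ∑ d ∈ Finset.range L, ∑ n ∈ Finset.range (L + 1 - 1 - d), (F (n + d + 1) n + F n (n + d + 1))
       = ∑ d ∈ Finset.range L, ∑ n ∈ Finset.range (L - 1 - d), (F (n + d + 1) n + F n (n + d + 1))
        + ∑ d ∈ Finset.range L, (F L (L - 1 - d) + F (L - 1 - d) L) := by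
      rw [← Finset.sum_add_distrib]
      refine Finset.sum_congr rfl fun d hd => ?_
      have hd' := Finset.mem_range.1 hd
      rw [show L + 1 - 1 - d = (L - 1 - d) + 1 by omega, Finset.sum_range_succ,
        show L - 1 - d + d + 1 = L by omega]
    rw [e2, Finset.sum_range_reflect (fun n => F L n + F n L) L]
    simp only [Nat.add_sub_cancel, Nat.sub_self, Finset.range_zero, Finset.sum_empty]
    ring

lemma weyl_diff (x : ℝ) (a L : ℕ) :
    ‖∑ n ∈ Finset.range L, ee (((a + n : ℕ) : ℝ) ^ 2 * x)‖ ^ 2 ≤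
      L + 2 * ∑ d ∈ Finset.range L, ‖∑ n ∈ Finset.range (L - 1 - d), ee (n * (((2 * (d + 1) : ℕ) : ℝ) * x))‖ := by
  set f : ℕ → ℂ := fun n => ee (((a + n : ℕ) : ℝ) ^ 2 * x) with hf
  have h1 : ((‖∑ n ∈ Finset.range L, f n‖ ^ 2 : ℝ) : ℂ) =
      ∑ m ∈ Finset.range L, ∑ n ∈ Finset.range L, f m * (starRingEnd ℂ) (f n) := by
    rw [← Finset.sum_mul_sum, ← map_sum]
    push_cast
    rw [Complex.mul_conj']
  have h2 : ∀ n, f n * (starRingEnd ℂ) (f n) = 1 := fun n => by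
    rw [Complex.mul_conj', hf]; simp [ee_norm]
  rw [sq_sum_expand] at h1
  simp_rw [h2] at h1
  have h3 : ‖∑ n ∈ Finset.range L, f n‖ ^ 2 = ‖((‖∑ n ∈ Finset.range L, f n‖ ^ 2 : ℝ) : ℂ)‖ := by
    rw [Complex.norm_real, Real.norm_of_nonneg (by positivity)]
  rw [h3, h1]
  refine (norm_add_le _ _).trans ?_
  gcongr
  · simp
  · rw [Finset.mul_sum]
    refine (norm_sum_le _ _).trans (Finset.sum_le_sum fun d _ => ?_)
    rw [Finset.sum_add_distrib, two_mul]
    have key : ∀ n, f (n + d + 1) * (starRingEnd ℂ) (f n) =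
        ee ((2 * a * (d + 1) + (d + 1) ^ 2) * x) * ee (n * (((2 * (d + 1) : ℕ) : ℝ) * x)) := fun n => by
      simp only [hf]
      rw [ee_conj, ← ee_add, ← ee_add]; congr 1; push_cast; ring
    have key2 : ‖∑ n ∈ Finset.range (L - 1 - d), f (n + d + 1) * (starRingEnd ℂ) (f n)‖ =
        ‖∑ n ∈ Finset.range (L - 1 - d), ee (n * (((2 * (d + 1) : ℕ) : ℝ) * x))‖ := by
      simp_rw [key]
      rw [← Finset.mul_sum, norm_mul, ee_norm, one_mul]
    refine (norm_add_le _ _).trans (add_le_add key2.le ?_)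
    rw [← key2, ← Complex.norm_conj, map_sum]
    refine le_of_eq ?_
    congr 1
    refine Finset.sum_congr rfl fun n _ => ?_
    simp [mul_comm]

noncomputable def phiB (u : ℝ) : ℝ := 1 / (2 * u) + 1 / (2 * (1 - u))

lemma sep (x : ℝ) (p : ℤ) (q : ℕ) (hq : 0 < q) (hcop : IsCoprime p (q : ℤ))
    (hap : |(q : ℝ) * x - p| ≤ 1 / q) (k : ℕ) (hk0 : 0 < k) (hk : 2 * k ≤ q) (z : ℤ) (hk1 : k < q) :
    1 / (2 * (q : ℝ)) ≤ |(k : ℝ) * x - z| := by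
  have hqR : (0 : ℝ) < q := by exact_mod_cast hq
  have h1 : (1 : ℝ) ≤ |(k : ℝ) * p - z * q| := by
    have : (k : ℤ) * p - z * q ≠ 0 := by
      intro h
      have hd : (q : ℤ) ∣ k * p := ⟨z, by linarith⟩
      have hd2 : (q : ℤ) ∣ k := hcop.symm.dvd_of_dvd_mul_right hd
      have := Int.le_of_dvd (by exact_mod_cast hk0) hd2
      omega
    have h2 : (1 : ℤ) ≤ |(k : ℤ) * p - z * q| := Int.one_le_abs this
    exact_mod_cast h2
  have h3 : (k : ℝ) * p - z * q = q * (k * x - z) - k * (q * x - p) := by ring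
  have h4 : |(k : ℝ) * p - z * q| ≤ q * |k * x - z| + k * (1 / q) := by
    rw [h3]
    refine (abs_sub _ _).trans ?_
    rw [abs_mul, abs_mul, abs_of_pos hqR, abs_of_nonneg (by positivity : (0:ℝ) ≤ k)]
    gcongr
  have h5 : (k : ℝ) * (1 / q) ≤ 1 / 2 := by
    have : (2 * k : ℝ) ≤ q := by exact_mod_cast hk
    rw [mul_one_div, div_le_div_iff₀ hqR (by norm_num)]; linarith
  rw [div_le_iff₀ (by positivity)]
  nlinarith

lemma phi_le (q : ℕ) (hq : 0 < q) (u : ℝ) (i : ℕ) (hi : i = ⌊2 * (q : ℝ) * u⌋₊) (hu : 0 ≤ u)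
    (h1 : u < 1)
    (hi0 : i ≠ 0) (hi1 : i ≠ 2 * q - 1) : phiB u ≤ q * (1 / (i : ℝ)) + q * (1 / ((2 * q - 1 - i : ℕ) : ℝ)) := by
  have hqR : (0 : ℝ) < q := by exact_mod_cast hq
  have ha : (i : ℝ) ≤ 2 * q * u := by rw [hi]; exact Nat.floor_le (by positivity)
  have hb : 2 * q * u < (i : ℝ) + 1 := by rw [hi]; exact Nat.lt_floor_add_one _
  have hlt : i < 2 * q := by
    have : (i : ℝ) < 2 * q := by nlinarith
    exact_mod_cast this
  have hiR : (0 : ℝ) < i := by exact_mod_cast Nat.pos_of_ne_zero hi0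
  have hu0 : 0 < u := by
    by_contra h
    have : u = 0 := le_antisymm (not_lt.1 h) hu
    rw [this] at ha; simp at ha; exact hi0 ha
  have hc : ((2 * q - 1 - i : ℕ) : ℝ) = 2 * q - 1 - i := by
    rw [Nat.cast_sub (by omega), Nat.cast_sub (by omega)]; push_cast; ring
  have hcpos : (0 : ℝ) < ((2 * q - 1 - i : ℕ) : ℝ) := by
    exact_mod_cast (by omega : 0 < 2 * q - 1 - i)
  unfold phiB
  gcongr ?_ + ?_
  · rw [mul_one_div, div_le_div_iff₀ (by positivity) hiR]; nlinarith
  · rw [mul_one_div, div_le_div_iff₀ (by linarith) hcpos, hc]; nlinarith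

lemma harm (n : ℕ) (hn : 0 < n) : ∑ i ∈ Finset.range n, 1 / (i : ℝ) ≤ 1 + Real.log n := by
  have h := harmonic_le_one_add_log (n - 1)
  have h2 : ((harmonic (n - 1) : ℚ) : ℝ) = ∑ i ∈ Finset.range n, 1 / (i : ℝ) := by
    obtain ⟨m, rfl⟩ : ∃ m, n = m + 1 := ⟨n - 1, by omega⟩
    rw [Finset.sum_range_succ', harmonic]
    push_cast
    simp
  rw [h2] at h
  refine h.trans ?_
  rcases Nat.eq_or_lt_of_le (Nat.succ_le_of_lt hn) with h' | h'
  · subst h'; simp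
  · have : Real.log ((n - 1 : ℕ) : ℝ) ≤ Real.log n := by
      apply Real.log_le_log
      · exact_mod_cast (by omega : 0 < n - 1)
      · exact_mod_cast (by omega : n - 1 ≤ n)
    linarith

noncomputable def Lam (q : ℕ) : ℝ := 1 + Real.log (2 * q : ℕ)

lemma Lam_ge (q : ℕ) : 1 ≤ Lam q := by
  unfold Lam
  have := Real.log_natCast_nonneg (2 * q)
  linarith

lemma block (x : ℝ) (p : ℤ) (q : ℕ) (hq : 0 < q) (hcop : IsCoprime p (q : ℤ))
    (hap : |(q : ℝ) * x - p| ≤ 1 / q) (L : ℝ) (hL : 0 ≤ L) (a : ℕ) :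
    ∑ d ∈ Finset.range ((q + 1) / 2), min L (phiB (Int.fract (((a + d : ℕ) : ℝ) * x))) ≤
      2 * L + 2 * q * Lam q := by
  have hqR : (0 : ℝ) < q := by exact_mod_cast hq
  set B := (q + 1) / 2 with hB
  set g : ℕ → ℕ := fun d => ⌊2 * (q : ℝ) * Int.fract (((a + d : ℕ) : ℝ) * x)⌋₊ with hg
  set H : ℕ → ℝ := fun i => (if i = 0 then L else 0) + (if i = 2 * q - 1 then L else 0)
     + (q * (1 / (i : ℝ)) + q * (1 / ((2 * q - 1 - i : ℕ) : ℝ))) with hH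
  have hHn : ∀ i, 0 ≤ H i := fun i => by
    simp only [hH]; split_ifs <;> positivity
  have hgm : ∀ d, g d < 2 * q := fun d => by
    simp only [hg]
    rw [Nat.floor_lt (by have := Int.fract_nonneg (((a + d : ℕ) : ℝ) * x); positivity)]
    push_cast
    have := Int.fract_lt_one (((a + d : ℕ) : ℝ) * x)
    push_cast at this
    nlinarith
  have hinj' : ∀ c d, c < d → d < B → g c ≠ g d := by
    intro c d hcd hdB h
    set u := Int.fract (((a + c : ℕ) : ℝ) * x) with hu
    set v := Int.fract (((a + d : ℕ) : ℝ) * x) with hv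
    have hu0 : 0 ≤ u := Int.fract_nonneg _
    have hv0 : 0 ≤ v := Int.fract_nonneg _
    have a1 : ((g c : ℕ) : ℝ) ≤ 2 * q * u := Nat.floor_le (by positivity)
    have a2 : 2 * q * u < (g c : ℕ) + 1 := Nat.lt_floor_add_one _
    have b1 : ((g d : ℕ) : ℝ) ≤ 2 * q * v := Nat.floor_le (by positivity)
    have b2 : 2 * q * v < (g d : ℕ) + 1 := Nat.lt_floor_add_one _
    rw [← h] at b1 b2
    have h1 : |v - u| < 1 / (2 * q) := by
      rw [lt_div_iff₀ (by positivity)]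
      have : |v - u| * (2 * q) = |2 * q * v - 2 * q * u| := by
        rw [← mul_sub, abs_mul, abs_of_pos (by positivity : (0:ℝ) < 2 * q)]; ring
      rw [this, abs_lt]; constructor <;> linarith
    have h2 := sep x p q hq hcop hap (d - c) (by omega) (by omega)
      (⌊((a + d : ℕ) : ℝ) * x⌋ - ⌊((a + c : ℕ) : ℝ) * x⌋) (by omega)
    have h3 : ((d - c : ℕ) : ℝ) * x - ((⌊((a + d : ℕ) : ℝ) * x⌋ - ⌊((a + c : ℕ) : ℝ) * x⌋ : ℤ) : ℝ)
        = v - u := by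
      rw [hu, hv, Int.fract, Int.fract, Nat.cast_sub hcd.le]; push_cast; ring
    rw [h3] at h2
    linarith
  have hinj : Set.InjOn g (Finset.range B : Set ℕ) := by
    intro c hc d hd h
    have hc' := Finset.mem_range.1 (Finset.mem_coe.1 hc)
    have hd' := Finset.mem_range.1 (Finset.mem_coe.1 hd)
    by_contra hne
    rcases Nat.lt_or_gt_of_ne hne with h' | h'
    · exact hinj' c d h' hd' h
    · exact hinj' d c h' hc' h.symm
  have step1 : ∀ d ∈ Finset.range B, min L (phiB (Int.fract (((a + d : ℕ) : ℝ) * x))) ≤ H (g d) := by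
    intro d _
    have hp : 0 ≤ q * (1 / (g d : ℝ)) + q * (1 / ((2 * q - 1 - g d : ℕ) : ℝ)) := by positivity
    by_cases c1 : g d = 0
    · refine (min_le_left _ _).trans ?_
      simp only [hH, if_pos c1]
      split_ifs <;> linarith
    by_cases c2 : g d = 2 * q - 1
    · refine (min_le_left _ _).trans ?_
      simp only [hH, if_pos c2]
      split_ifs <;> linarith
    refine (min_le_right _ _).trans ?_
    simp only [hH, if_neg c1, if_neg c2, zero_add]
    exact phi_le q hq _ (g d) rfl (Int.fract_nonneg _) (Int.fract_lt_one _) c1 c2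
  refine (Finset.sum_le_sum step1).trans ?_
  rw [← Finset.sum_image (f := H) hinj]
  refine (Finset.sum_le_sum_of_subset_of_nonneg (t := Finset.range (2 * q)) ?_ (fun i _ _ => hHn i)).trans ?_
  · intro i hi
    obtain ⟨d, _, rfl⟩ := Finset.mem_image.1 hi
    exact Finset.mem_range.2 (hgm d)
  simp only [hH]
  rw [Finset.sum_add_distrib, Finset.sum_add_distrib, Finset.sum_add_distrib, ← Finset.mul_sum,
    ← Finset.mul_sum, Finset.sum_range_reflect (fun i => 1 / (i : ℝ)) (2 * q)]
  have hh := harm (2 * q) (by omega)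
  rw [Finset.sum_ite_eq', Finset.sum_ite_eq', if_pos (by simp; omega), if_pos (by simp; omega)]
  unfold Lam
  nlinarith

lemma blocks (G : ℕ → ℝ) (B : ℕ) (K : ℝ) (h : ∀ a, ∑ d ∈ Finset.range B, G (a + d) ≤ K) (T : ℕ) :
    ∑ k ∈ Finset.range (T * B), G k ≤ T * K := by
  induction T with
  | zero => simp
  | succ T ih =>
    rw [Nat.succ_mul, Finset.sum_range_add]
    push_cast
    have := h (T * B)
    linarith

lemma even_sum (G : ℕ → ℝ) (hG : ∀ k, 0 ≤ G k) (L : ℕ) :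
    ∑ d ∈ Finset.range L, G (2 * (d + 1)) ≤ ∑ k ∈ Finset.range (2 * L + 1), G k := by
  induction L with
  | zero => simp [hG]
  | succ L ih =>
    rw [Finset.sum_range_succ, show 2 * (L + 1) + 1 = (2 * L + 1) + 1 + 1 by ring,
      Finset.sum_range_succ, Finset.sum_range_succ, show 2 * L + 1 + 1 = 2 * (L + 1) by ring]
    have := hG (2 * L + 1)
    linarith

lemma weyl (x : ℝ) (hirr : Irrational x) (p : ℤ) (q : ℕ) (hq : 0 < q) (hcop : IsCoprime p (q : ℤ))
    (hap : |(q : ℝ) * x - p| ≤ 1 / q) (a L : ℕ) :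
    ‖∑ n ∈ Finset.range L, ee (((a + n : ℕ) : ℝ) ^ 2 * x)‖ ^ 2 ≤
      L + 2 * ((4 * L / q + 3) * (2 * L + 2 * q * Lam q)) := by
  have hqR : (0 : ℝ) < q := by exact_mod_cast hq
  refine (weyl_diff x a L).trans ?_
  set G : ℕ → ℝ := fun k => min (L : ℝ) (phiB (Int.fract ((k : ℝ) * x))) with hGdef
  have hG : ∀ k, 0 ≤ G k := fun k => by
    have h1 := Int.fract_nonneg ((k : ℝ) * x)
    have h2 : 0 < 1 - Int.fract ((k : ℝ) * x) := by linarith [Int.fract_lt_one ((k : ℝ) * x)]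
    simp only [hGdef]
    unfold phiB
    refine le_min (by positivity) (by positivity)
  have hB : 0 < (q + 1) / 2 := by omega
  have hbl : ∀ a, ∑ d ∈ Finset.range ((q + 1) / 2), G (a + d) ≤ 2 * L + 2 * q * Lam q :=
    fun a => block x p q hq hcop hap L (by positivity) a
  set T := (2 * L) / ((q + 1) / 2) + 1 with hT
  have hTB : 2 * L + 1 ≤ T * ((q + 1) / 2) := by
    rw [hT]
    have := Nat.lt_div_mul_add (a := 2 * L) hB
    rw [add_mul (2 * L / ((q + 1) / 2)) 1 ((q + 1) / 2)]
    omega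
  have hTle : (T : ℝ) ≤ 4 * L / q + 3 := by
    rw [hT]; push_cast
    have h1 : (((2 * L) / ((q + 1) / 2) : ℕ) : ℝ) ≤ ((2 * L : ℕ) : ℝ) / (((q + 1) / 2 : ℕ) : ℝ) := Nat.cast_div_le
    have h2 : (q : ℝ) / 2 ≤ (((q + 1) / 2 : ℕ) : ℝ) := by
      have : (q : ℝ) ≤ 2 * (((q + 1) / 2 : ℕ) : ℝ) := by exact_mod_cast (by omega : q ≤ 2 * ((q + 1) / 2))
      linarith
    have h3 : ((2 * L : ℕ) : ℝ) / (((q + 1) / 2 : ℕ) : ℝ) ≤ ((2 * L : ℕ) : ℝ) / ((q : ℝ) / 2) := by gcongr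
    have h4 : ((2 * L : ℕ) : ℝ) / ((q : ℝ) / 2) = 4 * L / q := by push_cast; field_simp; ring
    linarith
  have hK : 0 ≤ 2 * (L : ℝ) + 2 * q * Lam q := by have := Lam_ge q; positivity
  gcongr
  calc ∑ d ∈ Finset.range L, ‖∑ n ∈ Finset.range (L - 1 - d), ee (n * (((2 * (d + 1) : ℕ) : ℝ) * x))‖
      ≤ ∑ d ∈ Finset.range L, G (2 * (d + 1)) := by
        refine Finset.sum_le_sum fun d hd => le_min ?_ ?_
        · refine (norm_sum_le _ _).trans ?_
          simp only [ee_norm, Finset.sum_const, Finset.card_range, nsmul_eq_mul, mul_one]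
          exact_mod_cast (by omega : L - 1 - d ≤ L)
        · refine geom_bound _ _ ?_
          refine lt_of_le_of_ne (Int.fract_nonneg _) (Ne.symm ?_)
          intro h
          have hir : Irrational (((2 * (d + 1) : ℕ) : ℝ) * x) := hirr.natCast_mul (by omega)
          rw [Int.fract_eq_iff] at h
          obtain ⟨_, _, z, hz⟩ := h
          rw [sub_zero] at hz
          exact hir ⟨z, by rw [hz]; simp⟩
    _ ≤ ∑ k ∈ Finset.range (2 * L + 1), G k := even_sum G hG L
    _ ≤ ∑ k ∈ Finset.range (T * ((q + 1) / 2)), G k :=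
        Finset.sum_le_sum_of_subset_of_nonneg (by simpa using hTB) (fun i _ _ => hG i)
    _ ≤ T * (2 * L + 2 * q * Lam q) := blocks G _ _ hbl T
    _ ≤ _ := by gcongr

lemma weyl_short (x : ℝ) (hirr : Irrational x) (p : ℤ) (q : ℕ) (hq : 0 < q) (hcop : IsCoprime p (q : ℤ))
    (hap : |(q : ℝ) * x - p| ≤ 1 / q) (a L : ℕ) (hL : L ≤ q) :
    ‖∑ n ∈ Finset.range L, ee (((a + n : ℕ) : ℝ) ^ 2 * x)‖ ^ 2 ≤ 100 * (q * Lam q) := by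
  refine (weyl x hirr p q hq hcop hap a L).trans ?_
  have hqR : (0 : ℝ) < q := by exact_mod_cast hq
  have hLq : (L : ℝ) ≤ q := by exact_mod_cast hL
  have h1 : 4 * (L : ℝ) / q ≤ 4 := by rw [div_le_iff₀ hqR]; linarith
  have h2 := Lam_ge q
  have h3 : (q : ℝ) ≤ q * Lam q := by nlinarith
  have hK : 0 ≤ 2 * (L : ℝ) + 2 * q * Lam q := by positivity
  nlinarith

lemma weyl_long (x : ℝ) (hirr : Irrational x) (p : ℤ) (q : ℕ) (hq : 0 < q) (hcop : IsCoprime p (q : ℤ))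
    (hap : |(q : ℝ) * x - p| ≤ 1 / q) (a L : ℕ) (hL : q ≤ L) :
    ‖∑ n ∈ Finset.range L, ee (((a + n : ℕ) : ℝ) ^ 2 * x)‖ ^ 2 ≤
      100 * ((L : ℝ) ^ 2 / q + L * Lam q) := by
  refine (weyl x hirr p q hq hcop hap a L).trans ?_
  have hqR : (0 : ℝ) < q := by exact_mod_cast hq
  have hLq : (q : ℝ) ≤ L := by exact_mod_cast hL
  have h2 := Lam_ge q
  have h1 : (1 : ℝ) ≤ L / q := by rw [le_div_iff₀ hqR]; linarith
  have hK : 0 ≤ 2 * (L : ℝ) + 2 * q * Lam q := by positivity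
  have h3 : (4 * (L : ℝ) / q + 3) ≤ 7 * (L / q) := by rw [mul_div_assoc]; linarith
  have h4 : 7 * ((L : ℝ) / q) * (2 * L + 2 * q * Lam q) = 14 * (L ^ 2 / q) + 14 * (L * Lam q) := by
    field_simp
    ring
  have h5 : (4 * (L : ℝ) / q + 3) * (2 * L + 2 * q * Lam q) ≤ 7 * (L / q) * (2 * L + 2 * q * Lam q) := by
    gcongr
  have h6 : (L : ℝ) ≤ L * Lam q := by nlinarith
  have h7 : 0 ≤ (L : ℝ) ^ 2 / q := by positivity
  rw [h4] at h5
  nlinarith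

lemma abel_bound (N : ℕ) (g : ℕ → ℂ) (τ : ℕ → ℝ) (K : ℝ)
    (hK : ∀ M, ‖∑ n ∈ Finset.range M, g n‖ ≤ K)
    (hm : ∀ n, n + 1 < N → τ n ≤ τ (n + 1)) (h0 : ∀ n, n < N → 0 ≤ τ n) (h1 : ∀ n, n < N → τ n ≤ 1) :
    ‖∑ n ∈ Finset.range N, (τ n : ℂ) * g n‖ ≤ 2 * K := by
  have hK0 : 0 ≤ K := (norm_nonneg _).trans (hK 0)
  rcases Nat.eq_zero_or_pos N with hN | hN
  · subst hN; simp [hK0]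
  have hbp := Finset.sum_range_by_parts (fun n => (τ n : ℂ)) g N
  simp only [smul_eq_mul] at hbp
  rw [hbp]
  refine (norm_sub_le _ _).trans ?_
  have e1 : ‖(τ (N - 1) : ℂ) * ∑ n ∈ Finset.range N, g n‖ ≤ K := by
    rw [norm_mul, Complex.norm_real, Real.norm_of_nonneg (h0 _ (by omega))]
    have := h1 (N - 1) (by omega)
    have := h0 (N - 1) (by omega)
    have := hK N
    have := norm_nonneg (∑ n ∈ Finset.range N, g n)
    nlinarith
  have e2 : ‖∑ i ∈ Finset.range (N - 1), ((τ (i + 1) : ℂ) - τ i) * ∑ n ∈ Finset.range (i + 1), g n‖ ≤ K := by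
    refine (norm_sum_le _ _).trans ?_
    have : ∀ i ∈ Finset.range (N - 1), ‖((τ (i + 1) : ℂ) - τ i) * ∑ n ∈ Finset.range (i + 1), g n‖ ≤
        (τ (i + 1) - τ i) * K := by
      intro i hi
      have hi' := Finset.mem_range.1 hi
      have hd := hm i (by omega)
      rw [norm_mul, ← Complex.ofReal_sub, Complex.norm_real, Real.norm_of_nonneg (by linarith)]
      have := hK (i + 1)
      gcongr
    refine (Finset.sum_le_sum this).trans ?_
    rw [← Finset.sum_mul, Finset.sum_range_sub]
    have := h1 (N - 1) (by omega)
    have := h0 0 (by omega)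
    nlinarith
  linarith

lemma inv_one_add_ee (θ : ℝ) (h : |θ| ≤ 1 / 4) (z : ℂ) :
    z = (1 / 2 - Complex.I / 2 * (Real.tan (π * θ) : ℝ)) * (z + ee θ * z) := by
  have hc : 0 < Real.cos (π * θ) := by
    apply Real.cos_pos_of_mem_Ioo
    have := Real.pi_pos
    obtain ⟨a, b⟩ := abs_le.1 h
    constructor <;> nlinarith
  have e1 : ee θ = (Real.cos (π * θ) + Real.sin (π * θ) * Complex.I) ^ 2 := by
    unfold ee
    push_cast
    rw [← Complex.exp_mul_I, ← Complex.exp_nat_mul]; congr 1; push_cast; ring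
  have hc' : (Real.cos (π * θ) : ℂ) ≠ 0 := by exact_mod_cast hc.ne'
  have hsc : (Real.sin (π * θ) : ℂ) ^ 2 + (Real.cos (π * θ) : ℂ) ^ 2 = 1 := by
    exact_mod_cast Real.sin_sq_add_cos_sq (π * θ)
  rw [e1, Real.tan_eq_sin_div_cos, Complex.ofReal_div]
  generalize (Real.cos (π * θ) : ℂ) = c at *
  generalize (Real.sin (π * θ) : ℂ) = s at *
  have hI : Complex.I ^ 2 = -1 := Complex.I_sq
  have e2 : 1 + (c + s * Complex.I) ^ 2 = 2 * c * (c + s * Complex.I) := by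
    linear_combination (s ^ 2) * hI - hsc
  have e3 : (1 / 2 - Complex.I / 2 * (s / c)) * (1 + (c + s * Complex.I) ^ 2) = 1 := by
    rw [e2]
    field_simp
    linear_combination (-s ^ 2) * hI + hsc
  linear_combination (-z) * e3

lemma tan_facts (y z : ℝ) (h0 : 0 ≤ y) (h : y ≤ z) (h1 : z ≤ 1 / 4) :
    0 ≤ Real.tan (π * y) ∧ Real.tan (π * y) ≤ Real.tan (π * z) ∧ Real.tan (π * z) ≤ 1 := by
  have hpi := Real.pi_pos
  have hmono := Real.strictMonoOn_tan.monotoneOn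
  have m : ∀ w, 0 ≤ w → w ≤ 1/4 → π * w ∈ Set.Ioo (-(π / 2)) (π / 2) := fun w a b => by
    constructor <;> nlinarith
  refine ⟨?_, ?_, ?_⟩
  · apply Real.tan_nonneg_of_nonneg_of_le_pi_div_two <;> nlinarith
  · exact hmono (m y h0 (by linarith)) (m z (by linarith) h1) (by gcongr)
  · rw [← Real.tan_pi_div_four, show π / 4 = π * (1 / 4) by ring]
    exact hmono (m z (by linarith) h1) (m _ (by norm_num) le_rfl) (by gcongr)

lemma two_mod_four (x : ℝ) (hirr : Irrational x) (p : ℤ) (q : ℕ) (hq : 0 < q) (hcop : IsCoprime p (q : ℤ))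
    (hq2 : q % 4 = 2) (Q : ℕ) (hQ : q ≤ Q)
    (hap : |(q : ℝ) * x - p| ≤ 1 / Q) (N : ℕ) (hN : q ≤ N) (hNQ : 5 * N ≤ Q) :
    ‖∑ n ∈ Finset.range N, ee (((1 + n : ℕ) : ℝ) ^ 2 * x)‖ ^ 2 ≤ 4000 * (q * Lam q) := by
  have hqR : (0 : ℝ) < q := by exact_mod_cast hq
  have hQR : (0 : ℝ) < Q := by exact_mod_cast (by omega : 0 < Q)
  have hqQ : (q : ℝ) ≤ Q := by exact_mod_cast hQ
  have hap' : |(q : ℝ) * x - p| ≤ 1 / q := hap.trans (one_div_le_one_div_of_le hqR hqQ)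
  obtain ⟨m, hm⟩ : ∃ m, q = 2 * m := ⟨q / 2, by omega⟩
  have hmodd : m % 2 = 1 := by omega
  have hmR : (0 : ℝ) < m := by exact_mod_cast (by omega : 0 < m)
  have hqm : (q : ℝ) = 2 * m := by exact_mod_cast hm
  have hpodd : p % 2 = 1 := by
    rcases Int.emod_two_eq_zero_or_one p with h | h
    · exfalso
      have h2 : (2 : ℤ) ∣ p := Int.dvd_of_emod_eq_zero h
      have h3 : (2 : ℤ) ∣ (q : ℤ) := ⟨m, by exact_mod_cast hm⟩
      have := hcop.isUnit_of_dvd' h2 h3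
      rw [Int.isUnit_iff] at this
      omega
    · exact h
  set D : ℝ := q * x - p with hD
  set f : ℕ → ℂ := fun n => ee (((1 + n : ℕ) : ℝ) ^ 2 * x) with hf
  set w : ℕ → ℝ := fun n => 2 * ((1 + n : ℕ) : ℝ) + m with hw
  have hanti : ∀ n, f (n + m) = -(ee (w n * D / 2) * f n) := by
    intro n
    simp only [hf]
    have e1 : ((1 + (n + m) : ℕ) : ℝ) ^ 2 * x = (((1 + n : ℕ) : ℤ) * p : ℤ) + ((m * p : ℤ) : ℝ) / 2 +
        (w n * D / 2 + ((1 + n : ℕ) : ℝ) ^ 2 * x) := by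
      simp only [hw, hD, hqm]; push_cast; ring
    rw [e1, ee_add, ee_add, ee_int, ee_half_odd, ee_add]
    · ring
    · rw [Int.odd_iff, Int.mul_emod, hpodd]; omega
  have hwb : ∀ n, n < N → 0 ≤ w n * |D| / 2 ∧ w n * |D| / 2 ≤ 1 / 4 := by
    intro n hn
    have hw0 : 0 ≤ w n := by simp only [hw]; positivity
    refine ⟨by positivity, ?_⟩
    have h1 : w n ≤ Q / 2 := by
      have : 4 * (1 + n) + 2 * m ≤ Q := by omega
      have : (4 * ((1 + n : ℕ) : ℝ) + 2 * m) ≤ Q := by exact_mod_cast this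
      simp only [hw]; linarith
    have h2 : w n * |D| ≤ Q / 2 * (1 / Q) := by gcongr
    have h3 : (Q : ℝ) / 2 * (1 / Q) = 1 / 2 := by field_simp
    linarith
  set R : ℝ := Real.sqrt (100 * (q * Lam q)) with hR
  have hLam := Lam_ge q
  have hsh : ∀ a, ‖∑ n ∈ Finset.range m, f (a + n)‖ ≤ R := by
    intro a
    apply Real.le_sqrt_of_sq_le
    have := weyl_short x hirr p q hq hcop hap' (1 + a) m (by omega)
    simp only [hf]
    simpa only [add_assoc] using this
  set g : ℕ → ℂ := fun n => f n - f (n + m) with hg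
  have hgs : ∀ M, ‖∑ n ∈ Finset.range M, g n‖ ≤ 2 * R := by
    intro M
    have e1 : ∑ n ∈ Finset.range M, g n = ∑ n ∈ Finset.range m, f (0 + n) - ∑ n ∈ Finset.range m, f (M + n) := by
      simp only [hg, Finset.sum_sub_distrib, zero_add]
      have a1 := Finset.sum_range_add f M m
      have a2 := Finset.sum_range_add f m M
      rw [add_comm m M] at a2
      simp only [add_comm m] at a2
      rw [a1] at a2
      linear_combination a2
    rw [e1]
    refine (norm_sub_le _ _).trans ?_
    linarith [hsh 0, hsh M]
  obtain ⟨σ, hσ, hσD⟩ : ∃ σ : ℝ, |σ| = 1 ∧ ∀ y : ℝ, Real.tan (π * (y * D / 2)) = σ * Real.tan (π * (y * |D| / 2)) := by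
    rcases le_total 0 D with h | h
    · exact ⟨1, by simp, fun y => by rw [abs_of_nonneg h, one_mul]⟩
    · refine ⟨-1, by simp, fun y => ?_⟩
      rw [abs_of_nonpos h, neg_one_mul, ← Real.tan_neg]; congr 1; ring
  set τ : ℕ → ℝ := fun n => Real.tan (π * (w n * |D| / 2)) with hτ
  have hab : ‖∑ n ∈ Finset.range N, (τ n : ℂ) * g n‖ ≤ 2 * (2 * R) := by
    apply abel_bound N g τ (2 * R) hgs
    · intro n hn
      refine (tan_facts _ _ (hwb n (by omega)).1 ?_ (hwb (n+1) hn).2).2.1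
      have : w n ≤ w (n + 1) := by simp only [hw]; push_cast; linarith
      gcongr
    · intro n hn
      exact (tan_facts _ _ (hwb n hn).1 le_rfl (hwb n hn).2).1
    · intro n hn
      exact (tan_facts _ _ (hwb n hn).1 le_rfl (hwb n hn).2).2.2
  have hsum : ∑ n ∈ Finset.range N, f n = (1 / 2 : ℂ) * ∑ n ∈ Finset.range N, g n
      - (Complex.I / 2 * (σ : ℝ)) * ∑ n ∈ Finset.range N, (τ n : ℂ) * g n := by
    rw [Finset.mul_sum, Finset.mul_sum, ← Finset.sum_sub_distrib]
    refine Finset.sum_congr rfl fun n hn => ?_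
    have hn' := Finset.mem_range.1 hn
    have h1 : |w n * D / 2| ≤ 1 / 4 := by
      have hw0 : 0 ≤ w n := by simp only [hw]; positivity
      rw [abs_div, abs_mul, abs_of_nonneg hw0, abs_of_pos (by norm_num : (0:ℝ) < 2)]
      exact (hwb n hn').2
    have h2 := inv_one_add_ee _ h1 (f n)
    have h3 : f n + ee (w n * D / 2) * f n = g n := by
      simp only [hg]; rw [hanti]; ring
    rw [h3, hσD] at h2
    rw [h2]; simp only [hτ]; push_cast; ring
  have hfin : ‖∑ n ∈ Finset.range N, f n‖ ≤ 3 * R := by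
    rw [hsum]
    refine (norm_sub_le _ _).trans ?_
    rw [norm_mul, norm_mul, norm_mul, norm_div, norm_div, Complex.norm_I, Complex.norm_real, Real.norm_eq_abs, hσ]
    have := hgs N
    simp only [norm_one, Complex.norm_ofNat]
    linarith
  have hR2 : R ^ 2 = 100 * (q * Lam q) := Real.sq_sqrt (by positivity)
  have hR0 : 0 ≤ R := Real.sqrt_nonneg _
  have h9 : 0 ≤ (q : ℝ) * Lam q := by positivity
  calc _ ≤ (3 * R) ^ 2 := by gcongr
    _ ≤ _ := by rw [mul_pow, hR2]; linarith


lemma cfX_facts (x : ℝ) (hx : x ∈ Set.Ioo (0 : ℝ) 1) (hirr : Irrational x) (j : ℕ) : 0 < cfX x j ∧ cfX x j < 1 ∧ Irrational (cfX x j) := by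
  induction j with
  | zero => exact ⟨hx.1, hx.2, hirr⟩
  | succ j ih =>
    obtain ⟨h0, h1, h2⟩ := ih
    have h3 : Irrational (cfX x (j + 1)) := by
      show Irrational (Int.fract (cfX x j)⁻¹)
      unfold Int.fract
      exact h2.inv.sub_intCast _
    refine ⟨?_, Int.fract_lt_one _, h3⟩
    exact lt_of_le_of_ne (Int.fract_nonneg _) (h3.ne_zero).symm

lemma cfA_pos (x : ℝ) (hx : x ∈ Set.Ioo (0 : ℝ) 1) (hirr : Irrational x) (j : ℕ) : 1 ≤ cfA x j := by
  obtain ⟨h0, h1, h2⟩ := cfX_facts x hx hirr j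
  unfold cfA
  rw [Int.le_floor]
  push_cast
  exact (one_le_inv₀ h0).2 h1.le

lemma cfQ_pos_mono (x : ℝ) (hx : x ∈ Set.Ioo (0 : ℝ) 1) (hirr : Irrational x) (j : ℕ) : 1 ≤ cfQ x j ∧ cfQ x j ≤ cfQ x (j + 1) := by
  induction j with
  | zero => exact ⟨le_rfl, cfA_pos x hx hirr 0⟩
  | succ j ih =>
    refine ⟨ih.1.trans ih.2, ?_⟩
    have := cfA_pos x hx hirr (j + 1)
    show _ ≤ cfA x (j + 1) * cfQ x (j + 1) + cfQ x j
    nlinarith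

lemma cfQ_ge (x : ℝ) (hx : x ∈ Set.Ioo (0 : ℝ) 1) (hirr : Irrational x) (j : ℕ) : (j : ℤ) ≤ cfQ x j := by
  induction j with
  | zero => exact zero_le_one
  | succ j ih =>
    cases j with
    | zero => simpa [cfQ] using cfA_pos x hx hirr 0
    | succ j =>
      have := cfA_pos x hx hirr (j + 1)
      have h1 := cfQ_pos_mono x hx hirr j
      have h2 := cfQ_pos_mono x hx hirr (j + 1)
      show _ ≤ cfA x (j + 1) * cfQ x (j + 1) + cfQ x j
      push_cast at *
      nlinarith

lemma cf_det (x : ℝ) (j : ℕ) : |cfP x (j + 1) * cfQ x j - cfP x j * cfQ x (j + 1)| = 1 := by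
  induction j with
  | zero => simp [cfP, cfQ]
  | succ j ih =>
    rw [← ih, ← abs_neg]
    congr 1
    show -((cfA x (j + 1) * cfP x (j + 1) + cfP x j) * cfQ x (j + 1) - cfP x (j + 1) * (cfA x (j + 1) * cfQ x (j + 1) + cfQ x j)) = _
    ring

lemma cf_coprime (x : ℝ) (hx : x ∈ Set.Ioo (0 : ℝ) 1) (hirr : Irrational x) (j : ℕ) : IsCoprime (cfP x j) (cfQ x j) := by
  have h := cf_det x j
  rcases (abs_eq zero_le_one).1 h with h | h
  · exact ⟨-cfQ x (j + 1), cfP x (j + 1), by linarith⟩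
  · exact ⟨cfQ x (j + 1), -cfP x (j + 1), by linarith⟩

lemma cf_inv (x : ℝ) (hx : x ∈ Set.Ioo (0 : ℝ) 1) (hirr : Irrational x) (j : ℕ) : x * (cfQ x (j + 1) + cfX x (j + 1) * cfQ x j) = cfP x (j + 1) + cfX x (j + 1) * cfP x j := by
  have key : ∀ j, (cfA x j : ℝ) + cfX x (j + 1) = (cfX x j)⁻¹ := fun j => Int.floor_add_fract _
  induction j with
  | zero =>
    have := key 0
    show x * ((cfA x 0 : ℤ) + cfX x 1 * ((1 : ℤ) : ℝ)) = ((1 : ℤ) : ℝ) + cfX x 1 * ((0 : ℤ) : ℝ)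
    push_cast
    rw [mul_one, this]
    show x * x⁻¹ = _
    rw [mul_inv_cancel₀ hx.1.ne']; ring
  | succ j ih =>
    have h1 := key (j + 1)
    have h2 := (cfX_facts x hx hirr (j + 1)).1.ne'
    show x * (((cfA x (j + 1) * cfQ x (j + 1) + cfQ x j : ℤ) : ℝ) + cfX x (j + 1 + 1) * cfQ x (j + 1)) =
      ((cfA x (j + 1) * cfP x (j + 1) + cfP x j : ℤ) : ℝ) + cfX x (j + 1 + 1) * cfP x (j + 1)
    push_cast
    have h3 : cfX x (j + 1 + 1) = (cfX x (j + 1))⁻¹ - cfA x (j + 1) := by linarith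
    rw [h3]
    field_simp
    linear_combination ih

lemma cf_approx (x : ℝ) (hx : x ∈ Set.Ioo (0 : ℝ) 1) (hirr : Irrational x) (j : ℕ) : |(cfQ x j : ℝ) * x - cfP x j| ≤ 1 / (cfQ x (j + 1) : ℝ) := by
  have h1 := cf_inv x hx hirr j
  have h2 : |(cfP x (j + 1) : ℝ) * cfQ x j - cfP x j * cfQ x (j + 1)| = 1 := by
    exact_mod_cast cf_det x j
  have hX := (cfX_facts x hx hirr (j + 1)).1
  have hq : (1 : ℝ) ≤ cfQ x j := by exact_mod_cast (cfQ_pos_mono x hx hirr j).1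
  have hq' : (1 : ℝ) ≤ cfQ x (j + 1) := by exact_mod_cast (cfQ_pos_mono x hx hirr (j + 1)).1
  have h3 : (cfP x (j + 1) : ℝ) * cfQ x j - cfP x j * cfQ x (j + 1) =
      ((cfQ x j : ℝ) * x - cfP x j) * (cfQ x (j + 1) + cfX x (j + 1) * cfQ x j) := by
    linear_combination (-(cfQ x j : ℝ)) * h1
  rw [h3, abs_mul, abs_of_pos (a := (cfQ x (j + 1) + cfX x (j + 1) * cfQ x j : ℝ)) (by positivity)] at h2
  rw [le_div_iff₀ (by linarith)]
  have : 0 ≤ |(cfQ x j : ℝ) * x - cfP x j| * (cfX x (j + 1) * cfQ x j) := by positivity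
  linarith

/-- From the rate: `(q_j q_{j+1})^t ≤ q_j`. -/
lemma cf_rate (x : ℝ) (hx : x ∈ Set.Ioo (0 : ℝ) 1) (hirr : Irrational x) (j : ℕ) (hj : 2 ≤ j) (t : ℝ) (ht : 0 < t) (hr : cfR x j ≤ t⁻¹) :
    ((cfQ x j : ℝ) * cfQ x (j + 1)) ^ t ≤ cfQ x j := by
  have hq2 : (2 : ℝ) ≤ cfQ x j := by
    exact_mod_cast (by exact_mod_cast hj : (2 : ℤ) ≤ j).trans (cfQ_ge x hx hirr j)
  have hq' : (1 : ℝ) ≤ cfQ x (j + 1) := by exact_mod_cast (cfQ_pos_mono x hx hirr (j + 1)).1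
  have hq0 : (0 : ℝ) < cfQ x j := by linarith
  have hH : cfH x j = ((cfQ x j : ℝ) * x - cfP x j) / cfQ x j := by unfold cfH; field_simp
  have hne : cfH x j ≠ 0 := by
    unfold cfH
    intro h
    exact hirr ⟨(cfP x j : ℚ) / (cfQ x j : ℚ), by push_cast; linarith⟩
  have hpos : 0 < |cfH x j| := abs_pos.2 hne
  have h1 : |cfH x j| * (cfQ x j * cfQ x (j + 1)) ≤ 1 := by
    rw [hH, abs_div, abs_of_pos hq0]
    have := cf_approx x hx hirr j
    rw [le_div_iff₀ (by linarith)] at this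
    calc _ = |(cfQ x j : ℝ) * x - cfP x j| * cfQ x (j + 1) := by field_simp
      _ ≤ 1 := this
  have h2 : (cfQ x j : ℝ) ^ (-t⁻¹) ≤ |cfH x j| := by
    rw [← Real.le_logb_iff_rpow_le (by linarith) hpos]
    unfold cfR at hr
    linarith
  have h3 : (cfQ x j : ℝ) * cfQ x (j + 1) ≤ (cfQ x j : ℝ) ^ t⁻¹ := by
    rw [Real.rpow_neg hq0.le] at h2
    have hp : 0 < (cfQ x j : ℝ) ^ t⁻¹ := by positivity
    have h4 : ((cfQ x j : ℝ) ^ t⁻¹)⁻¹ * (cfQ x j * cfQ x (j + 1)) ≤ 1 :=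
      le_trans (by gcongr) h1
    rwa [inv_mul_le_iff₀ hp, mul_one] at h4
  calc _ ≤ ((cfQ x j : ℝ) ^ t⁻¹) ^ t := by gcongr
    _ = cfQ x j := by rw [← Real.rpow_mul hq0.le, inv_mul_cancel₀ ht.ne', Real.rpow_one]


lemma Lam_mono (a b : ℕ) (ha : 0 < a) (h : a ≤ b) : Lam a ≤ Lam b := by
  unfold Lam
  have : Real.log ((2 * a : ℕ) : ℝ) ≤ Real.log ((2 * b : ℕ) : ℝ) := by
    apply Real.log_le_log
    · exact_mod_cast (by omega : 0 < 2 * a)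
    · exact_mod_cast (by omega : 2 * a ≤ 2 * b)
  linarith

lemma main_bound (x : ℝ) (hx : x ∈ Set.Ioo (0 : ℝ) 1) (hirr : Irrational x) (t : ℝ) (ht0 : 0 < t)
    (ht1 : t < 1 / 2) (J : ℕ) (hJ2 : 2 ≤ J)
    (hJ : ∀ j, J ≤ j → cfQ x j % 4 ≠ 2 → cfR x j ≤ t⁻¹) (N : ℕ) (hN : cfQ x J ≤ N) :
    ‖∑ n ∈ Finset.range N, ee (((1 + n : ℕ) : ℝ) ^ 2 * x)‖ ^ 2 ≤
      4000 * ((N : ℝ) ^ (2 - 2 * t) * Lam (5 * N ^ 2)) := by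
  have hex : ∃ k, (N : ℤ) < cfQ x (J + k) := by
    refine ⟨N + 1, ?_⟩
    have := cfQ_ge x hx hirr (J + (N + 1))
    push_cast at this
    linarith
  classical
  obtain ⟨j, hjJ, hj1, hj2⟩ : ∃ j, J ≤ j ∧ cfQ x j ≤ N ∧ (N : ℤ) < cfQ x (j + 1) := by
    have h1 := Nat.find_spec hex
    have h0 : Nat.find hex ≠ 0 := by
      intro h
      rw [h] at h1
      simp only [add_zero] at h1
      linarith
    refine ⟨J + (Nat.find hex - 1), by omega, ?_, ?_⟩
    · exact not_lt.1 (Nat.find_min hex (m := Nat.find hex - 1) (by omega))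
    · have : J + (Nat.find hex - 1) + 1 = J + Nat.find hex := by omega
      rwa [this]
  have hQ0 := (cfQ_pos_mono x hx hirr j).1
  have hQ1 := (cfQ_pos_mono x hx hirr (j + 1)).1
  have hQ2 := (cfQ_pos_mono x hx hirr (j + 1)).2
  have hap := cf_approx x hx hirr j
  have hap' := cf_approx x hx hirr (j + 1)
  have hc := cf_coprime x hx hirr j
  have hc' := cf_coprime x hx hirr (j + 1)
  have hrate := fun h => cf_rate x hx hirr j (by omega) t ht0 (hJ j hjJ h)
  generalize cfP x j = p at *
  generalize cfP x (j + 1) = p' at *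
  have hQ2R : (cfQ x (j + 1) : ℝ) ≤ cfQ x (j + 1 + 1) := by exact_mod_cast hQ2
  have hQ1R : (1 : ℝ) ≤ cfQ x (j + 1) := by exact_mod_cast hQ1
  replace hap' : |(cfQ x (j + 1) : ℝ) * x - p'| ≤ 1 / (cfQ x (j + 1) : ℝ) :=
    hap'.trans (one_div_le_one_div_of_le (by linarith) hQ2R)
  clear hQ2 hQ2R hQ1R hJ hex hN
  generalize cfQ x j = qz at *
  generalize cfQ x (j + 1) = qz' at *
  lift qz to ℕ using by omega with q
  lift qz' to ℕ using by omega with q'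
  simp only [Int.cast_natCast] at *
  have hq : 0 < q := by omega
  have hq' : 0 < q' := by omega
  have hqN : q ≤ N := by omega
  have hNq' : N < q' := by omega
  have hN0 : 0 < N := by omega
  have hqR : (0 : ℝ) < q := by exact_mod_cast hq
  have hqR' : (0 : ℝ) < q' := by exact_mod_cast hq'
  have hNR : (1 : ℝ) ≤ N := by exact_mod_cast hN0
  have hapq : |(q : ℝ) * x - p| ≤ 1 / q :=
    hap.trans (one_div_le_one_div_of_le hqR (by exact_mod_cast (by omega : q ≤ q')))
  set E : ℝ := (N : ℝ) ^ (2 - 2 * t) with hE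
  have hNE : (N : ℝ) ≤ E := by
    rw [hE]; conv_lhs => rw [← Real.rpow_one (N : ℝ)]
    exact Real.rpow_le_rpow_of_exponent_le hNR (by linarith)
  have hEN : E ≤ (N : ℝ) ^ 2 := by
    rw [hE, ← Real.rpow_natCast]
    exact Real.rpow_le_rpow_of_exponent_le hNR (by push_cast; linarith)
  have hE0 : 0 < E := by linarith
  set Λ := Lam (5 * N ^ 2) with hΛ
  have hΛ1 : 1 ≤ Λ := Lam_ge _
  have hNN : N ≤ N ^ 2 := Nat.le_self_pow (by norm_num) N
  have hEΛ : 0 < E * Λ := by positivity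
  by_cases h4 : (q : ℤ) % 4 ≠ 2
  · have hr := hrate h4
    by_cases hcase : N ^ 2 ≤ q * q'
    · skip
      refine (weyl_long x hirr p q hq hc hapq 1 N hqN).trans ?_
      have hcR : (N : ℝ) ^ 2 ≤ q * q' := by exact_mod_cast hcase
      have h1 : (N : ℝ) ^ (2 * t) ≤ q := by
        refine le_trans ?_ hr
        rw [Real.rpow_mul (by linarith)]
        have : (N : ℝ) ^ (2 : ℝ) = (N : ℝ) ^ 2 := by exact_mod_cast Real.rpow_natCast (N : ℝ) 2
        rw [this]
        gcongr
      have h2 : (N : ℝ) ^ 2 / q ≤ E := by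
        rw [div_le_iff₀ hqR]
        have : E * (N : ℝ) ^ (2 * t) = (N : ℝ) ^ 2 := by
          rw [hE, ← Real.rpow_add (by linarith), ← Real.rpow_natCast]; congr 1; push_cast; ring
        rw [← this]
        gcongr
      have h3 : (N : ℝ) * Lam q ≤ E * Λ :=
        mul_le_mul hNE (Lam_mono _ _ hq (by omega)) (by linarith [Lam_ge q]) hE0.le
      have h5 : E ≤ E * Λ := by nlinarith
      linarith
    · skip
      refine (weyl_short x hirr p' q' hq' hc' hap' 1 N hNq'.le).trans ?_
      have hcR : (q : ℝ) * q' ≤ (N : ℝ) ^ 2 := by exact_mod_cast (not_le.1 hcase).le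
      have h1 : (q' : ℝ) ≤ ((q : ℝ) * q') ^ (1 - t) := by
        rw [Real.rpow_sub (by positivity), Real.rpow_one, le_div_iff₀ (by positivity)]
        nlinarith
      have h2 : (q' : ℝ) ≤ E := by
        refine h1.trans ?_
        rw [hE, show 2 - 2 * t = 2 * (1 - t) by ring, Real.rpow_mul (by linarith)]
        have : (N : ℝ) ^ (2 : ℝ) = (N : ℝ) ^ 2 := by exact_mod_cast Real.rpow_natCast (N : ℝ) 2
        rw [this]
        have : 0 ≤ 1 - t := by linarith
        gcongr
      have h3 : q' ≤ N ^ 2 := by exact_mod_cast h2.trans hEN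
      have h4 : (q' : ℝ) * Lam q' ≤ E * Λ :=
        mul_le_mul h2 (Lam_mono _ _ hq' (by omega)) (by linarith [Lam_ge q']) hE0.le
      linarith
  · by_cases hcase : 5 * N ≤ q'
    · refine (two_mod_four x hirr p q hq hc (by omega) q' (by omega) hap N hqN hcase).trans ?_
      have h3 : (q : ℝ) * Lam q ≤ E * Λ :=
        mul_le_mul (le_trans (by exact_mod_cast hqN) hNE) (Lam_mono _ _ hq (by omega)) (by linarith [Lam_ge q]) hE0.le
      linarith
    · refine (weyl_short x hirr p' q' hq' hc' hap' 1 N hNq'.le).trans ?_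
      have h1 : (q' : ℝ) ≤ 5 * N := by exact_mod_cast (by omega : q' ≤ 5 * N)
      have h3 : (q' : ℝ) * Lam q' ≤ (5 * E) * Λ :=
        mul_le_mul (by linarith) (Lam_mono _ _ hq' (by omega)) (by linarith [Lam_ge q']) (by linarith)
      linarith

lemma power_bound (x : ℝ) (hx : x ∈ Set.Ioo (0 : ℝ) 1) (hirr : Irrational x) (t : ℝ) (ht0 : 0 < t)
    (ht1 : t < 1 / 2) (J : ℕ) (hJ2 : 2 ≤ J)
    (hJ : ∀ j, J ≤ j → cfQ x j % 4 ≠ 2 → cfR x j ≤ t⁻¹) (ε : ℝ) (hε : 0 < ε) :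
    ∃ C : ℝ, 0 ≤ C ∧ ∀ N : ℕ, cfQ x J ≤ N →
      ‖∑ n ∈ Finset.range N, ee (((1 + n : ℕ) : ℝ) ^ 2 * x)‖ ≤ C * (N : ℝ) ^ (1 - t + ε) := by
  refine ⟨Real.sqrt (4000 * (1 + 10 ^ ε / ε)), Real.sqrt_nonneg _, fun N hN => ?_⟩
  have hN1 : (1 : ℤ) ≤ N := (cfQ_pos_mono x hx hirr J).1.trans hN
  have hNR : (1 : ℝ) ≤ N := by exact_mod_cast hN1
  have h := main_bound x hx hirr t ht0 ht1 J hJ2 hJ N hN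
  have hN2 : (N : ℝ) ^ (2 : ℝ) = (N : ℝ) ^ 2 := by exact_mod_cast Real.rpow_natCast (N : ℝ) 2
  have hL : Lam (5 * N ^ 2) ≤ (1 + 10 ^ ε / ε) * (N : ℝ) ^ (2 * ε) := by
    unfold Lam
    have h1 : ((2 * (5 * N ^ 2) : ℕ) : ℝ) = 10 * (N : ℝ) ^ 2 := by push_cast; ring
    rw [h1]
    have h2 := Real.log_le_rpow_div (x := 10 * (N : ℝ) ^ 2) (by positivity) hε
    have h3 : (10 * (N : ℝ) ^ 2) ^ ε = 10 ^ ε * (N : ℝ) ^ (2 * ε) := by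
      rw [Real.mul_rpow (by norm_num) (by positivity), Real.rpow_mul (by linarith), hN2]
    rw [h3] at h2
    have h4 : 1 ≤ (N : ℝ) ^ (2 * ε) := Real.one_le_rpow hNR (by linarith)
    calc _ ≤ (N : ℝ) ^ (2 * ε) + 10 ^ ε * (N : ℝ) ^ (2 * ε) / ε := by linarith
      _ = _ := by ring
  have h5 : (N : ℝ) ^ (2 - 2 * t) * (N : ℝ) ^ (2 * ε) = ((N : ℝ) ^ (1 - t + ε)) ^ 2 := by
    rw [← Real.rpow_add (by linarith), ← Real.rpow_natCast, ← Real.rpow_mul (by linarith)]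
    congr 1; push_cast; ring
  refine le_of_sq_le_sq ?_ (by positivity)
  rw [mul_pow, Real.sq_sqrt (by positivity), ← h5]
  refine h.trans ?_
  calc _ ≤ 4000 * ((N : ℝ) ^ (2 - 2 * t) * ((1 + 10 ^ ε / ε) * (N : ℝ) ^ (2 * ε))) := by gcongr
    _ = _ := by ring

lemma rpow_diff (s : ℝ) (hs0 : 0 < s) (hs1 : s ≤ 1) (y : ℝ) (hy : 0 < y) :
    |(y + 1) ^ (-s) - y ^ (-s)| ≤ y ^ (-s - 1) := by
  have h1 : (y + 1) ^ (-s) ≤ y ^ (-s) :=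
    Real.rpow_le_rpow_of_nonpos hy (by linarith) (by linarith)
  rw [abs_of_nonpos (by linarith)]
  have h2 : y / (y + 1) ≤ (y / (y + 1)) ^ s := by
    conv_lhs => rw [← Real.rpow_one (y / (y + 1))]
    exact Real.rpow_le_rpow_of_exponent_ge (by positivity) (by rw [div_le_one (by linarith)]; linarith) hs1
  have h3 : (y + 1) ^ (-s) = y ^ (-s) * (y / (y + 1)) ^ s := by
    rw [Real.div_rpow hy.le (by linarith), Real.rpow_neg (by linarith), Real.rpow_neg hy.le]
    have : y ^ s ≠ 0 := (Real.rpow_pos_of_pos hy s).ne'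
    field_simp
  have h4 : y ^ (-s - 1) = y ^ (-s) * (1 / y) := by
    rw [Real.rpow_sub hy, Real.rpow_one]; ring
  have hp : 0 < y ^ (-s) := Real.rpow_pos_of_pos hy _
  have h5 : 1 - y / (y + 1) ≤ 1 / y := by
    have : 1 - y / (y + 1) = 1 / (y + 1) := by field_simp; ring
    rw [this]
    exact one_div_le_one_div_of_le hy (by linarith)
  rw [h3, h4]
  nlinarith

lemma conv_of_bound (s : ℝ) (hs0 : 0 < s) (hs1 : s ≤ 1) (a : ℕ → ℂ) (σ C : ℝ) (hσ : σ < s) (N0 : ℕ)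
    (h : ∀ N, N0 ≤ N → ‖∑ n ∈ Finset.range N, a n‖ ≤ C * (N : ℝ) ^ σ) :
    ∃ L : ℂ, Tendsto (fun N : ℕ => ∑ n ∈ Finset.range N, (((((n + 1 : ℕ) : ℝ) ^ (-s) : ℝ)) : ℂ) * a n)
      atTop (nhds L) := by
  set b : ℕ → ℂ := fun n => (((((n + 1 : ℕ) : ℝ) ^ (-s) : ℝ)) : ℂ) with hb
  set A : ℕ → ℂ := fun N => ∑ n ∈ Finset.range N, a n with hA
  have hsum : Summable (fun i => (b (i + 1) - b i) * A (i + 1)) := by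
    have hs2 : Summable (fun i : ℕ => C * ((i + 1 : ℕ) : ℝ) ^ (σ - s - 1)) := by
      apply Summable.mul_left
      exact (summable_nat_add_iff 1).2 (Real.summable_nat_rpow.2 (by linarith : σ - s - 1 < -1))
    refine Summable.of_norm_bounded_eventually_nat hs2 ?_
    filter_upwards [eventually_ge_atTop N0] with i hi
    have hy : (0 : ℝ) < ((i + 1 : ℕ) : ℝ) := by positivity
    rw [norm_mul]
    have e1 : ‖b (i + 1) - b i‖ ≤ ((i + 1 : ℕ) : ℝ) ^ (-s - 1) := by
      simp only [hb]
      rw [← Complex.ofReal_sub, Complex.norm_real, Real.norm_eq_abs]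
      have := rpow_diff s hs0 hs1 ((i + 1 : ℕ) : ℝ) hy
      rwa [show ((i + 1 + 1 : ℕ) : ℝ) = ((i + 1 : ℕ) : ℝ) + 1 by push_cast; ring]
    have e2 := h (i + 1) (by omega)
    calc ‖b (i + 1) - b i‖ * ‖A (i + 1)‖
        ≤ ((i + 1 : ℕ) : ℝ) ^ (-s - 1) * (C * ((i + 1 : ℕ) : ℝ) ^ σ) := by gcongr
      _ = C * (((i + 1 : ℕ) : ℝ) ^ (-s - 1) * ((i + 1 : ℕ) : ℝ) ^ σ) := by ring
      _ = _ := by rw [← Real.rpow_add hy]; congr 2; ring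
  have hlim1 : Tendsto (fun N : ℕ => b N * A (N + 1)) atTop (nhds 0) := by
    have ht : Tendsto (fun N : ℕ => C * ((N + 1 : ℕ) : ℝ) ^ (-(s - σ))) atTop (nhds 0) := by
      have h1 := (tendsto_rpow_neg_atTop (by linarith : 0 < s - σ)).comp
        (tendsto_natCast_atTop_atTop (R := ℝ))
      have h2 := (tendsto_add_atTop_iff_nat 1).2 h1
      simpa using h2.const_mul C
    refine squeeze_zero_norm' ?_ ht
    filter_upwards [eventually_ge_atTop N0] with i hi
    have hy : (0 : ℝ) < ((i + 1 : ℕ) : ℝ) := by positivity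
    have e2 := h (i + 1) (by omega)
    have e1 : ‖b i‖ = ((i + 1 : ℕ) : ℝ) ^ (-s) := by
      simp only [hb]
      rw [Complex.norm_real, Real.norm_of_nonneg (by positivity)]
    rw [norm_mul, e1]
    calc _ ≤ ((i + 1 : ℕ) : ℝ) ^ (-s) * (C * ((i + 1 : ℕ) : ℝ) ^ σ) := by gcongr
      _ = C * (((i + 1 : ℕ) : ℝ) ^ (-s) * ((i + 1 : ℕ) : ℝ) ^ σ) := by ring
      _ = _ := by rw [← Real.rpow_add hy]; congr 2; ring
  refine ⟨0 - ∑' i, (b (i + 1) - b i) * A (i + 1), ?_⟩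
  rw [← tendsto_add_atTop_iff_nat 1]
  refine (hlim1.sub hsum.hasSum.tendsto_sum_nat).congr fun N => ?_
  have := Finset.sum_range_by_parts b a (N + 1)
  simp only [smul_eq_mul, Nat.add_sub_cancel] at this
  rw [this]

/-- For `s ∈ (1/2,1]` and an irrational `x ∈ (0,1)`, if
`s - 1 + 1/r_odd(x) > 0` (with `1/∞ = 0`), then `F_{s,N}(x)` converges as `N → ∞`. -/
theorem converges_of_rOdd_condition (s : ℝ) (hs : s ∈ Set.Ioc (1/2 : ℝ) 1)
    (x : ℝ) (hx : x ∈ Set.Ioo (0 : ℝ) 1) (hirr : Irrational x)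
    (hcond : 0 < s - 1 + ((rOdd x)⁻¹).toReal) :
    ∃ L : ℂ, Filter.Tendsto (fun N : ℕ => FsN s N x) Filter.atTop (nhds L) := by
  obtain ⟨hs0, hs1⟩ := hs
  set r := (rOdd x)⁻¹ with hr
  obtain ⟨t, ht1, ht2⟩ : ∃ t, 1 - s < t ∧ t < min r.toReal (1 / 2) :=
    exists_between (lt_min (by linarith) (by linarith))
  have ht0 : 0 < t := by linarith
  have htr : t < r.toReal := ht2.trans_le (min_le_left _ _)
  have hth : t < 1 / 2 := ht2.trans_le (min_le_right _ _)
  have hrt : r ≠ ⊤ := by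
    intro h
    rw [h] at htr
    simp at htr
    linarith
  have h1 : ENNReal.ofReal t < r := (ENNReal.ofReal_lt_iff_lt_toReal ht0.le hrt).2 htr
  have h2 : rOdd x < ENNReal.ofReal t⁻¹ := by
    rw [ENNReal.ofReal_inv_of_pos ht0, ENNReal.lt_inv_iff_lt_inv]
    exact h1
  have h3 : ∀ᶠ j in oddFilter x, ENNReal.ofReal (cfR x j) < ENNReal.ofReal t⁻¹ :=
    eventually_lt_of_limsup_lt h2
  unfold oddFilter at h3
  rw [eventually_inf_principal, eventually_atTop] at h3
  obtain ⟨J0, hJ0⟩ := h3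
  have hJ : ∀ j, max J0 2 ≤ j → cfQ x j % 4 ≠ 2 → cfR x j ≤ t⁻¹ := by
    intro j hj h4
    have hj1 : J0 ≤ j := (le_max_left _ _).trans hj
    have hj2 : 2 ≤ j := (le_max_right _ _).trans hj
    have := hJ0 j hj1 ⟨by omega, h4⟩
    exact (ENNReal.ofReal_lt_ofReal_iff (by positivity)).1 this |>.le
  obtain ⟨C, hC, hb⟩ := power_bound x hx hirr t ht0 hth (max J0 2) (le_max_right _ _) hJ
    ((s - 1 + t) / 2) (by linarith)
  obtain ⟨L, hL⟩ := conv_of_bound s (by linarith) hs1 (fun n => ee (((1 + n : ℕ) : ℝ) ^ 2 * x))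
    (1 - t + (s - 1 + t) / 2) C (by linarith) (cfQ x (max J0 2)).toNat
    (fun N hN => hb N (Int.toNat_le.1 hN))
  refine ⟨L, hL.congr fun N => ?_⟩
  unfold FsN
  induction N with
  | zero => simp
  | succ N ih =>
    rw [Finset.sum_range_succ, Finset.sum_Icc_succ_top (by omega), ih]
    congr 2
    unfold ee
    congr 1
    push_cast
    ring
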